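/- Assume additionally that f is convex and argmin_Θ F is nonempty, and let (θ_n)_{n≥0} be the perturbed proximal gradient sequence with step sizes γ_n ∈ (0, 1/L] for all n ≥ 1. Then for every θ⋆ ∈ 𝓛 and all integers n ≥ m ≥ 0: ‖θ_{n+1} − θ⋆‖² ≤ ‖θ_m − θ⋆‖² − 2 Σ_{k=m}^{n} γ_{k+1} ⟨T_{γ_{k+1}}(θ_k) − θ⋆, η_{k+1}⟩ + 2 Σ_{k=m}^{n} γ_{k+1}² ‖η_{k+1}‖². -/

import Mathlib

open Filter MeasureTheory Finset
open scoped InnerProductSpace Topology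

noncomputable section

variable {E : Type*} [NormedAddCommGroup E] [InnerProductSpace ℝ E]

/-- Convexity of an `EReal`-valued function `g` (codomain `(-∞, +∞]`). -/
def ERealConvexOn (g : E → EReal) : Prop :=
  ∀ x y : E, ∀ a b : ℝ, 0 ≤ a → 0 ≤ b → a + b = 1 →
    g (a • x + b • y) ≤ (a : EReal) * g x + (b : EReal) * g y

/-- `p` minimizes `v ↦ g v + ‖v - θ‖² / (2γ)`. -/
def IsProxPt (g : E → EReal) (γ : ℝ) (θ p : E) : Prop :=
  ∀ v : E, g p + ((‖p - θ‖ ^ 2 / (2 * γ) : ℝ) : EReal)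
      ≤ g v + ((‖v - θ‖ ^ 2 / (2 * γ) : ℝ) : EReal)

/-- Subdifferential of an `EReal`-valued convex function at `θ`. -/
def subdiff (g : E → EReal) (θ : E) : Set E :=
  {u : E | ∀ v : E, g θ + ((⟪u, v - θ⟫_ℝ : ℝ) : EReal) ≤ g v}

/-- The set `𝓛 = {θ ∈ Dom g : 0 ∈ ∇f(θ) + ∂g(θ)}`. -/
def statPoints (f' : E → E) (g : E → EReal) : Set E :=
  {θ : E | g θ ≠ ⊤ ∧ -f' θ ∈ subdiff g θ}

/-- `F = f + g`, with values in `(-∞, +∞]`. -/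
def Fval (f : E → ℝ) (g : E → EReal) (θ : E) : EReal := (f θ : EReal) + g θ

/-- The real value of `F = f + g` (used at points of the domain of `g`). -/
def Freal (f : E → ℝ) (g : E → EReal) (θ : E) : ℝ := f θ + (g θ).toReal

/-- The proximal gradient map `T_γ(θ) = Prox_γ(θ - γ ∇f(θ))`. -/
def Tmap (prox : ℝ → E → E) (f' : E → E) (γ : ℝ) (θ : E) : E :=
  prox γ (θ - γ • f' θ)

variable [CompleteSpace E]

/-- Standing assumptions: `g` is convex, lower semicontinuous, proper, with values in
`(-∞, +∞]`; `f` is differentiable with `L`-Lipschitz gradient `f'`; and `prox γ θ`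
is the unique minimizer of `v ↦ g v + ‖v - θ‖²/(2γ)` for every `γ > 0`. -/
structure ProxSetting (f : E → ℝ) (f' : E → E) (g : E → EReal) (L : ℝ)
    (prox : ℝ → E → E) : Prop where
  g_ne_bot : ∀ x, g x ≠ ⊥
  g_ne_top : ∃ x, g x ≠ ⊤
  g_lsc : LowerSemicontinuous g
  g_conv : ERealConvexOn g
  f_grad : ∀ x, HasGradientAt f (f' x) x
  L_pos : 0 < L
  lip : ∀ x y, ‖f' x - f' y‖ ≤ L * ‖x - y‖
  prox_spec : ∀ γ : ℝ, 0 < γ → ∀ θ, IsProxPt g γ θ (prox γ θ)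
  prox_unique : ∀ γ : ℝ, 0 < γ → ∀ θ p, IsProxPt g γ θ p → p = prox γ θ

end

section Helpers
variable {E : Type*} [NormedAddCommGroup E] [InnerProductSpace ℝ E]

theorem aux_line [CompleteSpace E] {f : E → ℝ} {f' : E → E} (hf : ∀ x, HasGradientAt f (f' x) x)
    (x h : E) (t : ℝ) :
    HasDerivAt (fun s : ℝ => f (x + s • h)) (⟪f' (x + t • h), h⟫_ℝ) t := by
  have h1 : HasDerivAt (fun s : ℝ => x + s • h) h t := by
    simpa using ((hasDerivAt_id t).smul_const h).const_add x
  have h2 := (hf (x + t • h)).hasFDerivAt.comp_hasDerivAt t h1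
  simpa [Function.comp_def] using h2

theorem aux_convex [CompleteSpace E] {f : E → ℝ} {f' : E → E}
    (hf : ∀ x, HasGradientAt f (f' x) x)
    (hc : ConvexOn ℝ Set.univ f) (x y : E) : f x + ⟪f' x, y - x⟫_ℝ ≤ f y := by
  have hd := aux_line hf x (y - x) 0
  have hcv : ConvexOn ℝ Set.univ (fun s : ℝ => f (x + s • (y - x))) := by
    have := hc.comp_affineMap (AffineMap.lineMap x y : ℝ →ᵃ[ℝ] E)
    simpa [Function.comp_def, AffineMap.lineMap_apply, add_comm] using this
  have := hcv.le_slope_of_hasDerivAt (Set.mem_univ 0) (Set.mem_univ 1) zero_lt_one hd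
  simp [slope_def_field] at this
  linarith

theorem aux_descent [CompleteSpace E] {f : E → ℝ} {f' : E → E} {L : ℝ}
    (hf : ∀ x, HasGradientAt f (f' x) x)
    (hl : ∀ x y, ‖f' x - f' y‖ ≤ L * ‖x - y‖) (x y : E) :
    f y ≤ f x + ⟪f' x, y - x⟫_ℝ + L / 2 * ‖y - x‖ ^ 2 := by
  set h := y - x with hh
  have hd : ∀ t : ℝ, HasDerivAt
      (fun s : ℝ => f (x + s • h) - s * ⟪f' x, h⟫_ℝ - L / 2 * ‖h‖ ^ 2 * s ^ 2)
      (⟪f' (x + t • h), h⟫_ℝ - ⟪f' x, h⟫_ℝ - L / 2 * ‖h‖ ^ 2 * (2 * t)) t := by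
    intro t
    have := ((aux_line hf x h t).sub ((hasDerivAt_id t).mul_const ⟪f' x, h⟫_ℝ)).sub
      (((hasDerivAt_id t).pow 2).const_mul (L / 2 * ‖h‖ ^ 2))
    refine this.congr_deriv ?_
    simp
  have ha := antitoneOn_of_deriv_nonpos (convex_Icc (0:ℝ) 1)
    (fun t _ => (hd t).continuousAt.continuousWithinAt)
    (fun t _ => (hd t).differentiableAt.differentiableWithinAt)
    (fun t ht => by
      rw [(hd t).deriv, ← inner_sub_left]
      rw [interior_Icc] at ht
      have h1 := real_inner_le_norm (f' (x + t • h) - f' x) h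
      have h2 := hl (x + t • h) x
      rw [add_sub_cancel_left, norm_smul, Real.norm_of_nonneg ht.1.le] at h2
      have h3 := mul_le_mul_of_nonneg_right h2 (norm_nonneg h)
      nlinarith)
  have := ha (Set.left_mem_Icc.2 zero_le_one) (Set.right_mem_Icc.2 zero_le_one) zero_le_one
  simp [hh] at this
  rw [hh]
  linarith

theorem aux_prox_ne_top {g : E → EReal} {γ : ℝ} {z p v : E}
    (hp : IsProxPt g γ z p) (hv : g v ≠ ⊤) : g p ≠ ⊤ := by
  intro h
  have := hp v
  rw [h, EReal.top_add_coe, top_le_iff] at this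
  exact (EReal.add_ne_top hv (EReal.coe_ne_top _)) this

theorem aux_prox {g : E → EReal} {γ : ℝ} (hγ : 0 < γ) (hb : ∀ x, g x ≠ ⊥)
    (hc : ERealConvexOn g) {z p v : E}
    (hp : IsProxPt g γ z p) (hv : g v ≠ ⊤) :
    γ * ((g p).toReal - (g v).toReal) ≤ ⟪p - z, v - p⟫_ℝ := by
  have hpt := aux_prox_ne_top hp hv
  obtain ⟨a, ha⟩ : ∃ a : ℝ, g p = a := ⟨_, (EReal.coe_toReal hpt (hb p)).symm⟩
  obtain ⟨b, hbb⟩ : ∃ a : ℝ, g v = a := ⟨_, (EReal.coe_toReal hv (hb v)).symm⟩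
  rw [ha, hbb, EReal.toReal_coe, EReal.toReal_coe]
  have key : ∀ t : ℝ, 0 < t → t ≤ 1 →
      γ * (a - b) - ⟪p - z, v - p⟫_ℝ ≤ t * (‖v - p‖ ^ 2 / 2) := by
    intro t ht ht1
    have h1 := hc p v (1 - t) t (by linarith) ht.le (by ring)
    have h2 := hp ((1 - t) • p + t • v)
    have h3 := h2.trans (add_le_add_left h1 _)
    rw [ha, hbb] at h3
    norm_cast at h3
    have e : (1 - t) • p + t • v - z = (p - z) + t • (v - p) := by module
    rw [e, norm_add_sq_real, inner_smul_right, norm_smul, Real.norm_of_nonneg ht.le] at h3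
    have h4 := mul_le_mul_of_nonneg_left h3 (by positivity : 0 ≤ 2 * γ)
    field_simp at h4
    have h5 : t * (γ * (a - b) - ⟪p - z, v - p⟫_ℝ) ≤ t * (t * (‖v - p‖ ^ 2 / 2)) := by
      nlinarith
    exact le_of_mul_le_mul_left h5 ht
  by_contra hcon
  push Not at hcon
  set c := γ * (a - b) - ⟪p - z, v - p⟫_ℝ with hcdef
  have hcpos : 0 < c := by linarith
  set q := ‖v - p‖ ^ 2 / 2 with hq
  have hq0 : 0 ≤ q := by positivity
  have := key (c / (c + q + c)) (by positivity) ((div_le_one (by positivity)).2 (by linarith))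
  rw [div_mul_eq_mul_div, le_div_iff₀ (by positivity)] at this
  nlinarith

theorem aux_nonexp {g : E → EReal} {γ : ℝ} (hγ : 0 < γ) (hb : ∀ x, g x ≠ ⊥)
    (hc : ERealConvexOn g) {z p w q v : E} (hv : g v ≠ ⊤)
    (hp : IsProxPt g γ z p) (hq : IsProxPt g γ w q) : ‖p - q‖ ≤ ‖z - w‖ := by
  have h1 := aux_prox hγ hb hc hp (aux_prox_ne_top hq hv)
  have h2 := aux_prox hγ hb hc hq (aux_prox_ne_top hp hv)
  have h3 : ⟪p - z, q - p⟫_ℝ + ⟪q - w, p - q⟫_ℝ = ⟪z - w, p - q⟫_ℝ - ‖p - q‖ ^ 2 := by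
    rw [← real_inner_self_eq_norm_sq]
    simp only [inner_sub_left, inner_sub_right]
    ring
  have h4 := real_inner_le_norm (z - w) (p - q)
  by_contra hcon
  push Not at hcon
  have := norm_nonneg (z - w)
  nlinarith

theorem aux_step [CompleteSpace E] {f : E → ℝ} {f' : E → E} {g : E → EReal} {L : ℝ}
    {prox : ℝ → E → E} (hs : ProxSetting f f' g L prox) (hfconv : ConvexOn ℝ Set.univ f)
    {γ : ℝ} (hγ : 0 < γ) (hγL : γ ≤ 1 / L) (x p H η θs : E)
    (hp : p = prox γ (x - γ • H)) (hη : η = H - f' x) (hθ : θs ∈ statPoints f' g) :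
    ‖p - θs‖ ^ 2 ≤ ‖x - θs‖ ^ 2 - 2 * (γ * ⟪Tmap prox f' γ x - θs, η⟫_ℝ)
      + 2 * (γ ^ 2 * ‖η‖ ^ 2) := by
  have hP := hs.prox_spec γ hγ (x - γ • H)
  rw [← hp] at hP
  have hT := hs.prox_spec γ hγ (x - γ • f' x)
  change IsProxPt g γ _ (Tmap prox f' γ x) at hT
  set T := Tmap prox f' γ x
  have hne := aux_nonexp hγ hs.g_ne_bot hs.g_conv hθ.1 hT hP
  have e1 : x - γ • f' x - (x - γ • H) = γ • η := by rw [hη]; module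
  rw [e1, norm_smul, Real.norm_of_nonneg hγ.le] at hne
  have hv := aux_prox hγ hs.g_ne_bot hs.g_conv hP hθ.1
  have hpt := aux_prox_ne_top hP hθ.1
  have hsub := hθ.2 p
  rw [← EReal.coe_toReal hθ.1 (hs.g_ne_bot _), ← EReal.coe_toReal hpt (hs.g_ne_bot _)] at hsub
  norm_cast at hsub
  have hsub' := mul_le_mul_of_nonneg_left hsub hγ.le
  have c1 := aux_convex hs.f_grad hfconv x θs
  have c2 := aux_convex hs.f_grad hfconv θs p
  have c3 := aux_descent hs.f_grad hs.lip x p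
  have c4 : ⟪f' x, θs - x⟫_ℝ - ⟪f' x, p - x⟫_ℝ + ⟪f' θs, p - θs⟫_ℝ ≤ L / 2 * ‖p - x‖ ^ 2 := by
    linarith
  have c5 := mul_le_mul_of_nonneg_left c4 hγ.le
  have hγL' : γ * L ≤ 1 := (le_div_iff₀ hs.L_pos).1 hγL
  have c6 : γ * (L / 2 * ‖p - x‖ ^ 2) ≤ ‖p - x‖ ^ 2 / 2 := by
    nlinarith [sq_nonneg ‖p - x‖]
  have c7 := real_inner_le_norm (T - p) η
  have c8 := mul_le_mul_of_nonneg_right hne (norm_nonneg η)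
  have c9 : γ * ⟪T - p, η⟫_ℝ ≤ γ ^ 2 * ‖η‖ ^ 2 := by nlinarith
  have hH : H = f' x + η := by rw [hη]; abel
  have e2 : ⟪p - (x - γ • H), θs - p⟫_ℝ = (‖x - θs‖ ^ 2 - ‖p - θs‖ ^ 2 - ‖p - x‖ ^ 2) / 2
      + γ * (⟪f' x, θs - x⟫_ℝ - ⟪f' x, p - x⟫_ℝ) - γ * ⟪T - θs, η⟫_ℝ + γ * ⟪T - p, η⟫_ℝ := by
    rw [hH]
    simp only [← real_inner_self_eq_norm_sq, inner_sub_left, inner_sub_right, inner_smul_left,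
      inner_add_left, smul_add, real_inner_comm x p, real_inner_comm x θs, real_inner_comm p θs,
      real_inner_comm η θs, real_inner_comm η p, real_inner_comm η T]
    simp
    ring
  rw [e2] at hv
  rw [inner_neg_left] at hsub'
  nlinarith

end Helpers

/-- **Theorem 3.2 (i)** (basic recursion for the perturbed proximal gradient). -/
theorem stmt3
    {E : Type*} [NormedAddCommGroup E] [InnerProductSpace ℝ E] [FiniteDimensional ℝ E]
    (f : E → ℝ) (f' : E → E) (g : E → EReal) (L : ℝ) (prox : ℝ → E → E)
    (hs : ProxSetting f f' g L prox)
    (hfconv : ConvexOn ℝ Set.univ f)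
    (hargmin : ∃ m : E, ∀ v : E, Fval f g m ≤ Fval f g v)
    (γ : ℕ → ℝ) (hγ : ∀ n : ℕ, 1 ≤ n → 0 < γ n ∧ γ n ≤ 1 / L)
    (θ H η : ℕ → E) (hθ0 : g (θ 0) ≠ ⊤)
    (hrec : ∀ n : ℕ, θ (n + 1) = prox (γ (n + 1)) (θ n - γ (n + 1) • H (n + 1)))
    (hη : ∀ n : ℕ, η (n + 1) = H (n + 1) - f' (θ n))
 :
    ∀ θs ∈ statPoints f' g, ∀ m n : ℕ, m ≤ n →
      ‖θ (n + 1) - θs‖ ^ 2 ≤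
        ‖θ m - θs‖ ^ 2 -
            2 * ∑ k ∈ Finset.Icc m n,
              γ (k + 1) * ⟪Tmap prox f' (γ (k + 1)) (θ k) - θs, η (k + 1)⟫_ℝ +
          2 * ∑ k ∈ Finset.Icc m n, γ (k + 1) ^ 2 * ‖η (k + 1)‖ ^ 2 := by
  intro θs hθs m n hmn
  have step : ∀ k, _ := fun k => aux_step hs hfconv (hγ (k + 1) (by omega)).1
    (hγ (k + 1) (by omega)).2 (θ k) (θ (k + 1)) (H (k + 1)) (η (k + 1)) θs (hrec k) (hη k) hθs
  induction n, hmn using Nat.le_induction with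
  | base => simpa using step m
  | succ n hmn ih =>
    have := step (n + 1)
    rw [Finset.sum_Icc_succ_top (by omega), Finset.sum_Icc_succ_top (by omega)]
    linarith
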